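/- arXiv:2406.04219 — 2 statements merged into one kernel-verified Lean document; each statement's English description precedes it below -/
import Mathlib

section
/- (J-BC regret gap upper bound) There is a universal constant C such that in any finite Markov Game with deviation classes Φ, if the game is u-recoverable with respect to the expert σ_E, the expert satisfies β-coverage, and the learner σ satisfies the behavior-cloning guarantee E_{s∼d^{π_{σ_E}}}[ℓ_TV(σ_E(s), σ(s))] ≤ ε, then the regret gap satisfies R_Φ(σ) − R_Φ(σ_E) ≤ C·(1/β)·ε·u·H. -/
open scoped Classical

noncomputable section

namespace MAIL

/-- A finite Markov Game: horizon `H`, transition kernel `T`, per-agent rewards `r`,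
and initial state distribution `ρ₀`.  The agents are indexed by `Fin m`, the state
space is `S`, and agent `i` has action space `A i`; a joint action is an element of
`∀ i, A i`. -/
structure MG (m : ℕ) (S : Type) (A : Fin m → Type) where
  H : ℕ
  T : S → (∀ i, A i) → S → ℝ
  r : Fin m → S → (∀ i, A i) → ℝ
  ρ₀ : S → ℝ

variable {m : ℕ} {S : Type} {A : Fin m → Type} [Fintype S] [∀ i, Fintype (A i)]

/-- The Markov game data is valid: `ρ₀` and each `T s a` are probability
distributions, and all rewards take values in `[-1, 1]`. -/
def IsMG (G : MG m S A) : Prop :=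
  (∀ s, 0 ≤ G.ρ₀ s) ∧ (∑ s, G.ρ₀ s) = 1 ∧
  (∀ s a, (∀ s', 0 ≤ G.T s a s') ∧ (∑ s', G.T s a s') = 1) ∧
  (∀ i s a, |G.r i s a| ≤ 1)

/-- A (mediator or joint) policy is a stochastic map from states to joint actions.
When all agents obediently follow the mediator policy `σ`, the induced joint policy
`π_σ` is `σ` itself. -/
def IsPolicy (π : S → (∀ i, A i) → ℝ) : Prop :=
  ∀ s, (∀ a, 0 ≤ π s a) ∧ (∑ a, π s a) = 1

/-- Distribution over states at (0-indexed) step `h` under joint policy `π`. -/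
def stateDist (G : MG m S A) (π : S → (∀ i, A i) → ℝ) : ℕ → S → ℝ
  | 0 => G.ρ₀
  | h + 1 => fun s' => ∑ s, ∑ a, stateDist G π h s * π s a * G.T s a s'

/-- Expected cumulative reward over horizon `G.H` of joint policy `π` when every
agent's reward function is `f`, i.e. `J(π, f)`. -/
def Jf (G : MG m S A) (π : S → (∀ i, A i) → ℝ) (f : S → (∀ i, A i) → ℝ) : ℝ :=
  ∑ h ∈ Finset.range G.H, ∑ s, ∑ a, stateDist G π h s * π s a * f s a

/-- Value `J_i(π)` of joint policy `π` for agent `i` under the true rewards. -/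
def J (G : MG m S A) (i : Fin m) (π : S → (∀ i, A i) → ℝ) : ℝ :=
  Jf G π (G.r i)

/-- Occupancy measure `ρ^π(s, a) = (1/H) ∑_h Pr_π(s_h = s, a_h = a)`. -/
def occ (G : MG m S A) (π : S → (∀ i, A i) → ℝ) (s : S) (a : ∀ i, A i) : ℝ :=
  (∑ h ∈ Finset.range G.H, stateDist G π h s * π s a) / G.H

/-- Average state visitation distribution `d^π(s) = ∑_a ρ^π(s, a)`. -/
def dAvg (G : MG m S A) (π : S → (∀ i, A i) → ℝ) (s : S) : ℝ :=
  ∑ a, occ G π s a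

/-- The joint policy `π_{σ, φ_i}` obtained from mediator policy `σ` when agent `i`
deviates via `φ : S → A i → A i` (playing `φ s a` when recommended `a` at state `s`)
while all other agents follow their recommendations. -/
def dev (σ : S → (∀ i, A i) → ℝ) (i : Fin m) (φ : S → A i → A i) :
    S → (∀ i, A i) → ℝ :=
  fun s b => ∑ a : ∀ j, A j, if Function.update a i (φ s (a i)) = b then σ s a else 0

/-- Regret `R_Φ(σ, f)` of mediator policy `σ` w.r.t. deviation classes `Φ`, when
`f` is used as every agent's reward function. -/
def regretF (G : MG m S A) (σ : S → (∀ i, A i) → ℝ)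
    (Φ : ∀ i : Fin m, Set (S → A i → A i)) (f : S → (∀ i, A i) → ℝ) : ℝ :=
  ⨆ i : Fin m, ⨆ φ : Φ i, (Jf G (dev σ i φ.1) f - Jf G σ f)

/-- Regret `R_Φ(σ)` of mediator policy `σ` under the true rewards. -/
def regret (G : MG m S A) (σ : S → (∀ i, A i) → ℝ)
    (Φ : ∀ i : Fin m, Set (S → A i → A i)) : ℝ :=
  ⨆ i : Fin m, ⨆ φ : Φ i, (J G i (dev σ i φ.1) - J G i σ)

/-- Value-to-go `V` of joint policy `π` with `k` steps remaining (so the value from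
step `h` in the paper corresponds to `k = H - h` remaining steps), with every
agent's reward given by `f`. -/
def Vgo (G : MG m S A) (f : S → (∀ i, A i) → ℝ) (π : S → (∀ i, A i) → ℝ) :
    ℕ → S → ℝ
  | 0 => fun _ => 0
  | k + 1 => fun s => ∑ a, π s a * (f s a + ∑ s', G.T s a s' * Vgo G f π k s')

/-- Q-value of joint policy `π` with `k` steps remaining. -/
def Qgo (G : MG m S A) (f : S → (∀ i, A i) → ℝ) (π : S → (∀ i, A i) → ℝ)
    (k : ℕ) (s : S) (a : ∀ i, A i) : ℝ :=
  match k with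
  | 0 => 0
  | k + 1 => f s a + ∑ s', G.T s a s' * Vgo G f π k s'

/-- Advantage `A = Q - V` of joint policy `π` with `k` steps remaining. -/
def Adv (G : MG m S A) (f : S → (∀ i, A i) → ℝ) (π : S → (∀ i, A i) → ℝ)
    (k : ℕ) (s : S) (a : ∀ i, A i) : ℝ :=
  Qgo G f π k s a - Vgo G f π k s

/-- `u`-recoverability: the advantage of any expert-plus-single-deviation joint
policy `π_{σ_E, φ_i}` is bounded by `u` at every state, joint action, and step. -/
def Recoverable (G : MG m S A) (Φ : ∀ i : Fin m, Set (S → A i → A i))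
    (σE : S → (∀ i, A i) → ℝ) (u : ℝ) : Prop :=
  ∀ i : Fin m, ∀ φ ∈ Φ i, ∀ k ≤ G.H, ∀ s a, |Adv G (G.r i) (dev σE i φ) k s a| ≤ u

/-- `β`-coverage: the expert's average state distribution puts mass at least `β`
on every state. -/
def Coverage (G : MG m S A) (σE : S → (∀ i, A i) → ℝ) (β : ℝ) : Prop :=
  ∀ s, β ≤ dAvg G σE s

/-- Total variation distance between two finitely supported distributions. -/
def tv {α : Type} [Fintype α] (p q : α → ℝ) : ℝ :=
  (∑ a, |p a - q a|) / 2

lemma stateDist_nonneg {G : MG m S A} (hG : IsMG G) {π : S → (∀ i, A i) → ℝ}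
    (hπ : IsPolicy π) (h : ℕ) (s : S) : 0 ≤ stateDist G π h s := by
  induction h generalizing s with
  | zero => exact hG.1 s
  | succ h ih =>
    exact Finset.sum_nonneg fun s₀ _ => Finset.sum_nonneg fun a _ =>
      mul_nonneg (mul_nonneg (ih s₀) ((hπ s₀).1 a)) ((hG.2.2.1 s₀ a).1 s)

/-- Pushing the state distribution one step forward integrates functions along the dynamics. -/
lemma sum_stateDist_succ_mul (G : MG m S A) (π : S → (∀ i, A i) → ℝ) (h : ℕ) (g : S → ℝ) :
    ∑ s', stateDist G π (h + 1) s' * g s' =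
      ∑ s, stateDist G π h s * ∑ a, π s a * ∑ s', G.T s a s' * g s' := by
  simp only [stateDist, Finset.sum_mul, Finset.mul_sum]
  rw [Finset.sum_comm]
  refine Finset.sum_congr rfl fun s _ => ?_
  rw [Finset.sum_comm]
  exact Finset.sum_congr rfl fun a _ => Finset.sum_congr rfl fun s' _ => by ring

lemma sum_stateDist {G : MG m S A} (hG : IsMG G) {π : S → (∀ i, A i) → ℝ}
    (hπ : IsPolicy π) (h : ℕ) : ∑ s, stateDist G π h s = 1 := by
  induction h with
  | zero => exact hG.2.1
  | succ h ih =>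
    have := sum_stateDist_succ_mul G π h (fun _ => 1)
    simpa [(hG.2.2.1 _ _).2, (hπ _).2, ih] using this

/-- A policy has zero expected advantage over itself. -/
lemma sum_mul_adv_self (G : MG m S A) (f : S → (∀ i, A i) → ℝ) {π : S → (∀ i, A i) → ℝ}
    (hπ : IsPolicy π) (k : ℕ) (s : S) : ∑ a, π s a * Adv G f π k s a = 0 := by
  cases k with
  | zero => simp [Adv, Qgo, Vgo]
  | succ k => simp [Adv, Qgo, mul_sub, ← Finset.sum_mul, (hπ s).2, Vgo]

/-- Performance difference, as a bound: if the expected advantage over `π` of playing `π'` is at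
most `B` everywhere, the reward collected by `π'` from step `h` on is within `k * B` of the
expected value-to-go of `π`. -/
lemma abs_sum_reward_sub_sum_Vgo_le {G : MG m S A} (hG : IsMG G) (f : S → (∀ i, A i) → ℝ)
    (π : S → (∀ i, A i) → ℝ) {π' : S → (∀ i, A i) → ℝ} (hπ' : IsPolicy π') (B : ℝ) (k h : ℕ)
    (hB : ∀ j ≤ k, ∀ s, |∑ a, π' s a * Adv G f π j s a| ≤ B) :
    |∑ j ∈ Finset.range k, ∑ s, ∑ a, stateDist G π' (h + j) s * π' s a * f s a
      - ∑ s, stateDist G π' h s * Vgo G f π k s| ≤ k * B := by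
  induction k generalizing h with
  | zero => simp [Vgo]
  | succ k ih =>
    have hstep := ih (h + 1) fun j hj => hB j (hj.trans k.le_succ)
    have hadv : |∑ s, stateDist G π' h s * ∑ a, π' s a * Adv G f π (k + 1) s a| ≤ B :=
      calc _ ≤ ∑ s, |stateDist G π' h s * ∑ a, π' s a * Adv G f π (k + 1) s a| :=
            Finset.abs_sum_le_sum_abs _ _
        _ ≤ ∑ s, stateDist G π' h s * B := by
            refine Finset.sum_le_sum fun s _ => ?_
            rw [abs_mul, abs_of_nonneg (stateDist_nonneg hG hπ' h s)]
            exact mul_le_mul_of_nonneg_left (hB _ le_rfl s) (stateDist_nonneg hG hπ' h s)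
        _ = B := by rw [← Finset.sum_mul, sum_stateDist hG hπ', one_mul]
    have hexp : ∑ s, stateDist G π' h s * ∑ a, π' s a * Adv G f π (k + 1) s a =
        ∑ s, ∑ a, stateDist G π' h s * π' s a * f s a
          + ∑ s, stateDist G π' (h + 1) s * Vgo G f π k s
          - ∑ s, stateDist G π' h s * Vgo G f π (k + 1) s := by
      rw [sum_stateDist_succ_mul, ← Finset.sum_add_distrib, ← Finset.sum_sub_distrib]
      refine Finset.sum_congr rfl fun s _ => ?_
      simp only [Adv, Qgo, mul_sub, mul_add, Finset.sum_sub_distrib, Finset.sum_add_distrib,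
        ← Finset.sum_mul, (hπ' s).2, one_mul, mul_assoc, Finset.mul_sum]
    have hsplit : ∑ j ∈ Finset.range (k + 1), ∑ s, ∑ a, stateDist G π' (h + j) s * π' s a * f s a
        = ∑ s, ∑ a, stateDist G π' h s * π' s a * f s a + ∑ j ∈ Finset.range k,
          ∑ s, ∑ a, stateDist G π' (h + 1 + j) s * π' s a * f s a := by
      rw [Finset.sum_range_succ', add_comm]
      simp only [add_zero, add_assoc, add_comm 1]
    rw [hexp] at hadv
    rw [hsplit]
    rw [abs_le] at *
    push_cast
    constructor <;> linarith [hstep.1, hstep.2, hadv.1, hadv.2]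

/-- The gap between the values of two policies is controlled by the advantage bound of one of them
and the `L¹` distance between them. -/
lemma abs_Jf_sub_Jf_le {G : MG m S A} (hG : IsMG G) (f : S → (∀ i, A i) → ℝ)
    {π π' : S → (∀ i, A i) → ℝ} (hπ : IsPolicy π) (hπ' : IsPolicy π') {u δ : ℝ} (hu : 0 ≤ u)
    (hadv : ∀ k ≤ G.H, ∀ s a, |Adv G f π k s a| ≤ u)
    (hδ : ∀ s, ∑ a, |π' s a - π s a| ≤ δ) :
    |Jf G π' f - Jf G π f| ≤ G.H * (δ * u) := by
  have h₁ := abs_sum_reward_sub_sum_Vgo_le hG f π hπ' (δ * u) G.H 0 fun k hk s => by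
    calc |∑ a, π' s a * Adv G f π k s a|
        = |∑ a, (π' s a - π s a) * Adv G f π k s a| := by
          simp only [sub_mul, Finset.sum_sub_distrib, sum_mul_adv_self G f hπ, sub_zero]
      _ ≤ ∑ a, |(π' s a - π s a) * Adv G f π k s a| := Finset.abs_sum_le_sum_abs _ _
      _ ≤ ∑ a, |π' s a - π s a| * u := Finset.sum_le_sum fun a _ => by
          rw [abs_mul]
          exact mul_le_mul_of_nonneg_left (hadv k hk s a) (abs_nonneg _)
      _ ≤ δ * u := by
          rw [← Finset.sum_mul]
          exact mul_le_mul_of_nonneg_right (hδ s) hu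
  have h₂ := abs_sum_reward_sub_sum_Vgo_le hG f π hπ 0 G.H 0 fun k _ s => by
    rw [sum_mul_adv_self G f hπ, abs_zero]
  simp only [zero_add, stateDist, mul_zero] at h₁ h₂
  have h₃ := sub_eq_zero.1 (abs_nonpos_iff.1 h₂)
  rw [← h₃] at h₁
  exact h₁

lemma sum_dev (σ : S → (∀ i, A i) → ℝ) (i : Fin m) (φ : S → A i → A i) (s : S) :
    ∑ b, dev σ i φ s b = ∑ a, σ s a := by
  simp only [dev]
  rw [Finset.sum_comm]
  simp

lemma isPolicy_dev {σ : S → (∀ i, A i) → ℝ} (hσ : IsPolicy σ) (i : Fin m)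
    (φ : S → A i → A i) : IsPolicy (dev σ i φ) := by
  refine fun s => ⟨fun b => Finset.sum_nonneg fun a _ => ?_, ?_⟩
  · split_ifs
    exacts [(hσ s).1 a, le_rfl]
  · rw [sum_dev, (hσ s).2]

lemma dev_id (σ : S → (∀ i, A i) → ℝ) (i : Fin m) : dev σ i (fun _ a => a) = σ := by
  funext s b
  simp [dev]

/-- Deviations do not increase the `L¹` distance between mediator policies. -/
lemma sum_abs_dev_sub_dev_le (σ σ' : S → (∀ i, A i) → ℝ) (i : Fin m) (φ : S → A i → A i)
    (s : S) : ∑ b, |dev σ i φ s b - dev σ' i φ s b| ≤ ∑ a, |σ s a - σ' s a| := by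
  rw [← sum_dev (fun s a => |σ s a - σ' s a|) i φ s]
  refine Finset.sum_le_sum fun b _ => ?_
  simp only [dev]
  rw [← Finset.sum_sub_distrib]
  refine (Finset.abs_sum_le_sum_abs _ _).trans_eq (Finset.sum_congr rfl fun a _ => ?_)
  split_ifs <;> simp

/-- A uniform bound on the change of all deviation gains bounds the change of the regret. -/
lemma regret_le_regret_add (G : MG m S A) (hm : 0 < m) (Φ : ∀ i : Fin m, Set (S → A i → A i))
    (hΦ : ∀ i, (Φ i).Nonempty) (σE σ : S → (∀ i, A i) → ℝ) (c : ℝ)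
    (hc : ∀ i, ∀ φ ∈ Φ i,
      J G i (dev σ i φ) - J G i σ ≤ J G i (dev σE i φ) - J G i σE + c) :
    regret G σ Φ ≤ regret G σE Φ + c := by
  have : Nonempty (Fin m) := ⟨⟨0, hm⟩⟩
  refine ciSup_le fun i => ?_
  have : Nonempty (Φ i) := (hΦ i).to_subtype
  refine ciSup_le fun φ => (hc i φ.1 φ.2).trans ?_
  gcongr
  exact (le_ciSup (f := fun φ : Φ i => J G i (dev σE i φ.1) - J G i σE)
      (Set.finite_range _).bddAbove φ).trans
    (le_ciSup (f := fun i => ⨆ φ : Φ i, (J G i (dev σE i φ.1) - J G i σE))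
      (Set.finite_range _).bddAbove i)

/-- Under coverage, an average total variation bound becomes a pointwise `L¹` bound. -/
lemma sum_abs_sub_le_of_coverage {G : MG m S A} {σE σ : S → (∀ i, A i) → ℝ} {β ε : ℝ}
    (hβ : 0 < β) (hcov : Coverage G σE β)
    (hε : ∑ s, dAvg G σE s * tv (σE s) (σ s) ≤ ε) (s : S) :
    ∑ a, |σ s a - σE s a| ≤ 2 * (ε / β) := by
  have htv : ∀ s, 0 ≤ tv (σE s) (σ s) := fun s =>
    div_nonneg (Finset.sum_nonneg fun a _ => abs_nonneg _) zero_le_two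
  have h₁ : dAvg G σE s * tv (σE s) (σ s) ≤ ε :=
    (Finset.single_le_sum (f := fun s => dAvg G σE s * tv (σE s) (σ s))
      (fun s _ => mul_nonneg (hβ.le.trans (hcov s)) (htv s)) (Finset.mem_univ s)).trans hε
  have h₂ : tv (σE s) (σ s) ≤ ε / β := by
    rw [le_div_iff₀ hβ, mul_comm]
    exact (mul_le_mul_of_nonneg_right (hcov s) (htv s)).trans h₁
  simp only [abs_sub_comm (σ s _)]
  unfold tv at h₂
  linarith

/-- **J-BC regret gap upper bound.** There is a universal constant `C`
such that in any `u`-recoverable finite Markov Game whose expert satisfies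
`β`-coverage, a behavior-cloning guarantee of `ε` implies a regret gap of at most
`C·(1/β)·ε·u·H`. -/
theorem jbc_regret_gap_upper_bound :
    ∃ C : ℝ, 0 < C ∧
      ∀ (m : ℕ) (S : Type) (A : Fin m → Type) [Fintype S] [∀ i, Fintype (A i)]
        (G : MG m S A), IsMG G → 0 < m →
        ∀ (Φ : ∀ i : Fin m, Set (S → A i → A i)),
        (∀ i : Fin m, (fun (_ : S) (a : A i) => a) ∈ Φ i) →
        ∀ (σE σ : S → (∀ i, A i) → ℝ), IsPolicy σE → IsPolicy σ →
        ∀ (u β ε : ℝ), Recoverable G Φ σE u → 0 < β → Coverage G σE β →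
        (∑ s, dAvg G σE s * tv (σE s) (σ s)) ≤ ε →
        regret G σ Φ - regret G σE Φ ≤ C * (1 / β) * ε * u * G.H := by
  refine ⟨4, by norm_num, ?_⟩
  intro m S A _ _ G hG hm Φ hid σE σ hE hσ u β ε hrec hβ hcov hε
  have hS : Nonempty S := by
    by_contra h
    have := not_nonempty_iff.1 h
    simpa using hG.2.1
  have hA : Nonempty (∀ i, A i) := by
    by_contra h
    have := not_nonempty_iff.1 h
    simpa using (hE hS.some).2
  have hu : 0 ≤ u := (abs_nonneg _).trans
    (hrec ⟨0, hm⟩ _ (hid _) 0 (Nat.zero_le _) hS.some hA.some)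
  have hval : ∀ i, ∀ φ ∈ Φ i,
      |J G i (dev σ i φ) - J G i (dev σE i φ)| ≤ G.H * (2 * (ε / β) * u) := fun i φ hφ =>
    abs_Jf_sub_Jf_le hG (G.r i) (isPolicy_dev hE i φ) (isPolicy_dev hσ i φ) hu (hrec i φ hφ)
      fun s => (sum_abs_dev_sub_dev_le σ σE i φ s).trans
        (sum_abs_sub_le_of_coverage hβ hcov hε s)
  rw [sub_le_iff_le_add']
  refine regret_le_regret_add G hm Φ (fun i => ⟨_, hid i⟩) σE σ _ fun i φ hφ => ?_
  have h₁ := hval i φ hφ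
  have h₂ := hval i _ (hid i)
  rw [dev_id, dev_id] at h₂
  rw [abs_le] at h₁ h₂
  have h₃ : 4 * (1 / β) * ε * u * G.H = 2 * (G.H * (2 * (ε / β) * u)) := by ring
  rw [h₃]
  linarith [h₁.2, h₂.1]

end MAIL
end
end

section
/- (J-BC regret gap lower bound) There is a universal constant c > 0 such that for all integers u ≥ 3 and horizons H ≥ u, all β ∈ (0, 1/4], and all ε > 0 with ε·H ≤ β, there exist a finite Markov Game with horizon H, complete deviation classes Φ, an expert policy σ_E satisfying u-recoverability and β-coverage, and a learner policy σ with behavior-cloning error E_{s∼d^{π_{σ_E}}}[ℓ_TV(σ_E(s), σ(s))] ≤ ε, such that the regret gap satisfies R_Φ(σ) − R_Φ(σ_E) ≥ c·(1/β)·ε·u·H. -/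
open scoped Classical

noncomputable section

namespace MAIL

variable {m : ℕ} {S : Type} {A : Fin m → Type} [Fintype S] [∀ i, Fintype (A i)]

/-- Deterministic part of the dynamics of the hard game.  State `2` is the rewarding state; from
state `1` it is reached only when both agents play action `1`, and state `1` is reached from
state `0` when the first agent plays action `1`. -/
def hardStep (s : Fin 3) (a : Fin 2 → Fin 2) : Fin 3 :=
  if s = 0 then (if a 0 = 0 then 0 else 1)
  else if s = 1 then (if a 0 = 1 ∧ a 1 = 1 then 2 else 1) else 2

/-- Initial distribution of the hard game, also used for resampling the state. -/
def hardInit (β : ℝ) : Fin 3 → ℝ := ![1 - 2 * β, β, β]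

/-- The hard game: at each step the state is resampled with probability `1 / u` and otherwise
evolves according to `hardStep`.  The first agent is rewarded in state `2`, the second never. -/
def hardGame (u H : ℕ) (β : ℝ) : MG 2 (Fin 3) (fun _ => Fin 2) where
  H := H
  T := fun s a s' =>
    (1 - 1 / (u : ℝ)) * (if s' = hardStep s a then 1 else 0) + 1 / (u : ℝ) * hardInit β s'
  r := fun i s _ => if i = 0 ∧ s = 2 then 1 else 0
  ρ₀ := hardInit β

/-- The mediator recommending action `0` to the first agent, and action `1` to the second agent
with probability `p s`. -/
def secondErrs (p : Fin 3 → ℝ) (s : Fin 3) (a : Fin 2 → Fin 2) : ℝ :=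
  if a 0 = 0 then (if a 1 = 0 then 1 - p s else p s) else 0

/-- The joint policy `π` plays `α s` for the first agent, and `1` with probability `p s` for the
second agent. -/
def PlaysAs (π : Fin 3 → (Fin 2 → Fin 2) → ℝ) (α : Fin 3 → Fin 2) (p : Fin 3 → ℝ) : Prop :=
  ∀ s (f : (Fin 2 → Fin 2) → ℝ),
    ∑ a, π s a * f a = (1 - p s) * f ![α s, 0] + p s * f ![α s, 1]

lemma sum_fin_two_arrow (f : (Fin 2 → Fin 2) → ℝ) :
    ∑ a, f a = f ![0, 0] + f ![0, 1] + f ![1, 0] + f ![1, 1] := by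
  rw [← (finTwoArrowEquiv (Fin 2)).symm.sum_comp, Fintype.sum_prod_type]
  simp [Fin.sum_univ_two, finTwoArrowEquiv, add_assoc]

lemma playsAs_secondErrs (p : Fin 3 → ℝ) : PlaysAs (secondErrs p) (fun _ => 0) p := by
  intro s f
  rw [sum_fin_two_arrow]
  simp [secondErrs]

lemma sum_dev_mul {m : ℕ} {S : Type} {A : Fin m → Type} [∀ i, Fintype (A i)]
    (σ : S → (∀ i, A i) → ℝ) (i : Fin m) (φ : S → A i → A i) (s : S) (f : (∀ i, A i) → ℝ) :
    ∑ b, dev σ i φ s b * f b = ∑ a, σ s a * f (Function.update a i (φ s (a i))) := by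
  simp only [dev, Finset.sum_mul]
  rw [Finset.sum_comm]
  refine Finset.sum_congr rfl fun a _ => ?_
  simp [ite_mul]

lemma playsAs_dev (p : Fin 3 → ℝ) (φ : Fin 3 → Fin 2 → Fin 2) :
    PlaysAs (dev (A := fun _ => Fin 2) (secondErrs p) 0 φ) (fun s => φ s 0) p := by
  intro s f
  rw [sum_dev_mul (A := fun _ => Fin 2), playsAs_secondErrs p s
    (fun a => f (Function.update a 0 (φ s (a 0))))]
  have h (b : Fin 2) : Function.update (![0, b] : Fin 2 → Fin 2) 0 (φ s 0) = ![φ s 0, b] := by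
    ext j; fin_cases j <;> simp
  simp [h]

lemma isPolicy_secondErrs {p : Fin 3 → ℝ} (h0 : ∀ s, 0 ≤ p s) (h1 : ∀ s, p s ≤ 1) :
    IsPolicy (A := fun _ => Fin 2) (secondErrs p) := by
  refine fun s => ⟨fun a => ?_, ?_⟩
  · have := h0 s
    have := h1 s
    unfold secondErrs
    split_ifs <;> linarith
  · have := playsAs_secondErrs p s (fun _ => 1)
    simpa using this

section Dynamics

variable {u H : ℕ} {β : ℝ}

lemma hardGame_T (s : Fin 3) (a : Fin 2 → Fin 2) (s' : Fin 3) :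
    (hardGame u H β).T s a s' = (1 - 1 / (u : ℝ)) * (if s' = hardStep s a then 1 else 0) +
      1 / (u : ℝ) * hardInit β s' := rfl

lemma sum_hardInit : ∑ s, hardInit β s = 1 := by
  simp [hardInit, Fin.sum_univ_three]; ring

lemma hardInit_nonneg (h0 : 0 ≤ β) (h1 : β ≤ 1 / 4) (s : Fin 3) : 0 ≤ hardInit β s := by
  fin_cases s <;> simp [hardInit] <;> linarith

lemma sum_hardGame_T_mul (s : Fin 3) (a : Fin 2 → Fin 2) (f : Fin 3 → ℝ) :
    ∑ s', (hardGame u H β).T s a s' * f s' =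
      (1 - 1 / (u : ℝ)) * f (hardStep s a) + 1 / (u : ℝ) * ∑ s', hardInit β s' * f s' := by
  simp only [hardGame_T, add_mul, Finset.sum_add_distrib, Finset.mul_sum, mul_assoc]
  simp

lemma isMG_hardGame (hu : 3 ≤ u) (h0 : 0 ≤ β) (h1 : β ≤ 1 / 4) : IsMG (hardGame u H β) := by
  have hu' : (3 : ℝ) ≤ u := by exact_mod_cast hu
  have hr : 1 / (u : ℝ) ≤ 1 := by rw [div_le_one (by linarith)]; linarith
  refine ⟨hardInit_nonneg h0 h1, sum_hardInit, fun s a => ⟨fun s' => ?_, ?_⟩, fun i s a => ?_⟩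
  · rw [hardGame_T]
    have := hardInit_nonneg h0 h1 s'
    have : 0 ≤ 1 - 1 / (u : ℝ) := by linarith
    split_ifs <;> positivity
  · have := sum_hardGame_T_mul (u := u) (H := H) (β := β) s a (fun _ => 1)
    simpa [sum_hardInit] using this
  · simp only [hardGame]
    split_ifs <;> simp

variable {π : Fin 3 → (Fin 2 → Fin 2) → ℝ} {α : Fin 3 → Fin 2} {p : Fin 3 → ℝ}

lemma stateDist_succ (hπ : PlaysAs π α p) (h : ℕ) (s' : Fin 3) :
    stateDist (hardGame u H β) π (h + 1) s' = ∑ s, stateDist (hardGame u H β) π h s *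
      ((1 - p s) * (hardGame u H β).T s ![α s, 0] s' +
        p s * (hardGame u H β).T s ![α s, 1] s') := by
  simp only [stateDist, mul_assoc, ← Finset.mul_sum]
  exact Finset.sum_congr rfl fun s _ => by rw [hπ s (fun a => (hardGame u H β).T s a s')]

lemma J_zero_eq (hπ : PlaysAs π α p) :
    J (hardGame u H β) 0 π = ∑ h ∈ Finset.range H, stateDist (hardGame u H β) π h 2 := by
  unfold J Jf
  refine Finset.sum_congr rfl fun h _ => ?_
  simp only [mul_assoc, ← Finset.mul_sum]
  have (s : Fin 3) := hπ s ((hardGame u H β).r 0 s)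
  simp only [this]
  simp [Fin.sum_univ_three, hardGame]

lemma J_one_eq : J (hardGame u H β) 1 π = 0 := by
  simp [J, Jf, hardGame]

lemma sum_stateDist_s8 (hπ : PlaysAs π α p) (h : ℕ) :
    ∑ s, stateDist (hardGame u H β) π h s = 1 := by
  induction h with
  | zero => exact sum_hardInit
  | succ h ih =>
    have hT (s : Fin 3) (a : Fin 2 → Fin 2) : ∑ s', (hardGame u H β).T s a s' = 1 := by
      have := sum_hardGame_T_mul (u := u) (H := H) (β := β) s a (fun _ => 1)
      simpa [sum_hardInit] using this
    simp only [stateDist_succ hπ]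
    rw [Finset.sum_comm]
    refine Eq.trans ?_ ih
    refine Finset.sum_congr rfl fun s _ => ?_
    rw [← Finset.mul_sum, Finset.sum_add_distrib, ← Finset.mul_sum, ← Finset.mul_sum, hT, hT]
    ring

/-- Without errors of the second agent, no deviation changes the visits to the rewarding state. -/
lemma stateDist_two_of_no_error (hπ : PlaysAs π α 0) (h : ℕ) :
    stateDist (hardGame u H β) π h 2 = β := by
  induction h with
  | zero => simp [stateDist, hardGame, hardInit]
  | succ h ih =>
    have hs := sum_stateDist_s8 (u := u) (H := H) (β := β) hπ h
    have h0 : hardStep 0 ![α 0, 0] ≠ 2 := by simp only [hardStep]; split_ifs <;> simp_all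
    have h1 : hardStep 1 ![α 1, 0] = 1 := by simp [hardStep]
    have h2 : hardStep 2 ![α 2, 0] = 2 := by simp [hardStep]
    simp only [Fin.sum_univ_three] at hs
    rw [stateDist_succ hπ]
    simp only [Fin.sum_univ_three, hardGame_T]
    simp [h0.symm, h1, h2, hardInit]
    linear_combination (1 - (u : ℝ)⁻¹) * ih + (u : ℝ)⁻¹ * β * hs

/-- If the first agent is obedient, the state distribution is stationary. -/
lemma stateDist_of_obedient (hπ : PlaysAs π (fun _ => 0) p) (h : ℕ) :
    stateDist (hardGame u H β) π h = hardInit β := by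
  induction h with
  | zero => rfl
  | succ h ih =>
    have hstep (s : Fin 3) (b : Fin 2) : hardStep s ![0, b] = s := by
      fin_cases s <;> simp [hardStep]
    have hs := sum_hardInit (β := β)
    ext s'
    rw [stateDist_succ hπ, ih]
    simp only [hardGame_T, hstep]
    simp only [Fin.sum_univ_three] at hs ⊢
    fin_cases s' <;> simp
    · linear_combination (u : ℝ)⁻¹ * hardInit β 0 * hs
    · linear_combination (u : ℝ)⁻¹ * hardInit β 1 * hs
    · linear_combination (u : ℝ)⁻¹ * hardInit β 2 * hs

lemma dAvg_secondErrs_zero (hH : 0 < H) (s : Fin 3) :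
    dAvg (hardGame u H β) (secondErrs 0) s = hardInit β s := by
  have hH' : (H : ℝ) ≠ 0 := by positivity
  have hp := playsAs_secondErrs 0 s (fun _ => 1)
  simp only [mul_one] at hp
  simp only [dAvg, occ, stateDist_of_obedient (playsAs_secondErrs 0)]
  rw [← Finset.sum_div]
  simp only [Finset.sum_const, ← Finset.mul_sum, hp, nsmul_eq_mul]
  simp [hardGame, hH']

lemma Vgo_no_error (hu : 3 ≤ u) (hπ : PlaysAs π α 0) (k : ℕ) :
    let V := Vgo (hardGame u H β) ((hardGame u H β).r 0) π k
    V 0 = V 1 ∧ 0 ≤ V 2 - V 1 ∧ V 2 - V 1 ≤ u := by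
  have hu' : (3 : ℝ) ≤ u := by exact_mod_cast hu
  have hr : 1 / (u : ℝ) ≤ 1 := by rw [div_le_one (by linarith)]; linarith
  have hr' : 1 / (u : ℝ) * u = 1 := by field_simp
  induction k with
  | zero => simp [Vgo]
  | succ k ih =>
    obtain ⟨h01, hlo, hhi⟩ := ih
    set W := Vgo (hardGame u H β) ((hardGame u H β).r 0) π k with hW
    have key (s : Fin 3) : Vgo (hardGame u H β) ((hardGame u H β).r 0) π (k + 1) s =
        (if s = 2 then 1 else 0) + ((1 - 1 / (u : ℝ)) * W (hardStep s ![α s, 0]) +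
          1 / (u : ℝ) * ∑ s', hardInit β s' * W s') := by
      have := hπ s (fun a => (hardGame u H β).r 0 s a +
        ∑ s', (hardGame u H β).T s a s' * W s')
      simp only [Vgo, ← hW, this]
      simp only [sum_hardGame_T_mul]
      simp [hardGame]
    have e0 : W (hardStep 0 ![α 0, 0]) = W 1 := by
      simp only [hardStep]; split_ifs <;> simp_all
    have e1 : hardStep 1 ![α 1, 0] = 1 := by simp [hardStep]
    have e2 : hardStep 2 ![α 2, 0] = 2 := by simp [hardStep]
    have n1 : ¬ (1 : Fin 3) = 2 := by decide
    simp only [key, e0, e1, e2, n1, if_true, if_false]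
    refine ⟨by simp, ?_, ?_⟩
    · have : 0 ≤ (1 - 1 / (u : ℝ)) * (W 2 - W 1) := mul_nonneg (by linarith) hlo
      linarith
    · have : (1 - 1 / (u : ℝ)) * (W 2 - W 1) ≤ (1 - 1 / (u : ℝ)) * u :=
        mul_le_mul_of_nonneg_left hhi (by linarith)
      linarith

lemma abs_Adv_le (hu : 3 ≤ u) (hπ : PlaysAs π α 0) (k : ℕ) (s : Fin 3) (a : Fin 2 → Fin 2) :
    |Adv (hardGame u H β) ((hardGame u H β).r 0) π k s a| ≤ u := by
  have hu' : (3 : ℝ) ≤ u := by exact_mod_cast hu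
  have hr : 1 / (u : ℝ) ≤ 1 := by rw [div_le_one (by linarith)]; linarith
  have hr0 : 0 ≤ 1 / (u : ℝ) := by positivity
  cases k with
  | zero => simp [Adv, Qgo, Vgo]
  | succ k =>
    obtain ⟨h01, hlo, hhi⟩ := Vgo_no_error (H := H) (β := β) hu hπ k
    set W := Vgo (hardGame u H β) ((hardGame u H β).r 0) π k with hW
    have key : Adv (hardGame u H β) ((hardGame u H β).r 0) π (k + 1) s a =
        (1 - 1 / (u : ℝ)) * (W (hardStep s a) - W (hardStep s ![α s, 0])) := by
      have := hπ s (fun a => (hardGame u H β).r 0 s a +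
        ∑ s', (hardGame u H β).T s a s' * W s')
      simp only [Adv, Qgo, Vgo, ← hW, this]
      simp only [sum_hardGame_T_mul]
      simp [hardGame]
      ring
    have hd (s₁ s₂ : Fin 3) : |W s₁ - W s₂| ≤ u := by
      rw [abs_le]
      fin_cases s₁ <;> fin_cases s₂ <;> simp <;> constructor <;> linarith
    rw [key, abs_mul, abs_of_nonneg (by linarith)]
    calc (1 - 1 / (u : ℝ)) * |W (hardStep s a) - W (hardStep s ![α s, 0])|
        ≤ 1 * u := mul_le_mul (by linarith) (hd _ _) (abs_nonneg _) (by norm_num)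
      _ = u := one_mul _

lemma recoverable_hardGame (hu : 3 ≤ u) (Φ : ∀ _ : Fin 2, Set (Fin 3 → Fin 2 → Fin 2)) :
    Recoverable (hardGame u H β) Φ (secondErrs 0) (u : ℝ) := by
  intro i φ _ k _ s a
  obtain rfl | rfl : i = 0 ∨ i = 1 := by fin_cases i <;> simp
  · exact abs_Adv_le hu (playsAs_dev 0 φ) k s a
  · have hV (π : Fin 3 → (Fin 2 → Fin 2) → ℝ) (k : ℕ) :
        Vgo (hardGame u H β) ((hardGame u H β).r 1) π k = 0 := by
      induction k with
      | zero => rfl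
      | succ k ih => ext s; simp only [Vgo, ih]; simp [hardGame]
    cases k with
    | zero => simp [Adv, Qgo, Vgo]
    | succ k => simp [Adv, Qgo, hV]; simp [hardGame]

lemma regret_hardGame_expert :
    regret (hardGame u H β) (secondErrs 0) (fun _ => Set.univ) = 0 := by
  have h (i : Fin 2) (φ : Fin 3 → Fin 2 → Fin 2) :
      J (hardGame u H β) i (dev (A := fun _ => Fin 2) (secondErrs 0) i φ) -
        J (hardGame u H β) i (secondErrs 0) = 0 := by
    obtain rfl | rfl : i = 0 ∨ i = 1 := by fin_cases i <;> simp
    · rw [J_zero_eq (playsAs_dev 0 φ), J_zero_eq (playsAs_secondErrs 0)]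
      simp only [stateDist_two_of_no_error (playsAs_dev 0 φ),
        stateDist_two_of_no_error (playsAs_secondErrs 0), sub_self]
    · simp only [J_one_eq, sub_self]
  simp [regret, h]

lemma le_regret {m : ℕ} {S : Type} {A : Fin m → Type} [Fintype S] [∀ i, Fintype (A i)]
    (G : MG m S A) (σ : S → (∀ i, A i) → ℝ) (i : Fin m) (φ : S → A i → A i) :
    J G i (dev σ i φ) - J G i σ ≤ regret G σ (fun _ => Set.univ) := by
  refine le_ciSup_of_le (Set.finite_range _).bddAbove i ?_
  exact le_ciSup_of_le (Set.finite_range _).bddAbove ⟨φ, Set.mem_univ _⟩ le_rfl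

variable {η : ℝ}

/-- Lower bound on the visits to the rewarding state when the first agent always plays `1`. -/
lemma stateDist_two_lower (hu : 3 ≤ u) (huH : u ≤ H) (h0 : 0 ≤ β) (h1 : β ≤ 1 / 4)
    (hη : 0 ≤ η) (hηH : η * H ≤ 1 / 4) (hπ : PlaysAs π (fun _ => 1) ![0, η, 0]) (h : ℕ)
    (hh : h < H) :
    β + η / 18 * (u / H) * h ≤ stateDist (hardGame u H β) π (h + 1) 2 := by
  have hu' : (3 : ℝ) ≤ u := by exact_mod_cast hu
  have huH' : (u : ℝ) ≤ H := by exact_mod_cast huH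
  have hH : (0 : ℝ) < H := by linarith
  set ι := (u : ℝ)⁻¹ with hι
  have hι0 : 0 ≤ ι := by positivity
  have hι1 : ι ≤ 1 / 3 := by
    rw [hι, inv_eq_one_div]; exact one_div_le_one_div_of_le (by norm_num) hu'
  have hη1 : η ≤ 1 := by nlinarith
  let x := stateDist (hardGame u H β) π
  have hsum (h : ℕ) : x h 0 + x h 1 + x h 2 = 1 := by
    have := sum_stateDist_s8 (u := u) (H := H) (β := β) hπ h
    rwa [Fin.sum_univ_three] at this
  have hx0 (h : ℕ) : x (h + 1) 0 = ι * (1 - 2 * β) := by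
    have := stateDist_succ (u := u) (H := H) (β := β) hπ h 0
    simp only [Fin.sum_univ_three, hardGame_T] at this
    simp [hardStep, hardInit] at this
    simp only [x, this]
    linear_combination ι * (1 - 2 * β) * hsum h
  have hx1 (h : ℕ) : x (h + 1) 1 = (1 - ι) * (x h 0 + (1 - η) * x h 1) + ι * β := by
    have := stateDist_succ (u := u) (H := H) (β := β) hπ h 1
    simp only [Fin.sum_univ_three, hardGame_T] at this
    simp [hardStep, hardInit] at this
    simp only [x, this]
    linear_combination ι * β * hsum h
  have hx2 (h : ℕ) : x (h + 1) 2 = (1 - ι) * (x h 2 + η * x h 1) + ι * β := by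
    have := stateDist_succ (u := u) (H := H) (β := β) hπ h 2
    simp only [Fin.sum_univ_three, hardGame_T] at this
    simp [hardStep, hardInit] at this
    simp only [x, this]
    linear_combination ι * β * hsum h
  have hx00 : x 0 0 = 1 - 2 * β := by simp [x, stateDist, hardGame, hardInit]
  have hx01 : x 0 1 = β := by simp [x, stateDist, hardGame, hardInit]
  have hx02 : x 0 2 = β := by simp [x, stateDist, hardGame, hardInit]
  have hnn (h : ℕ) : 0 ≤ x h 0 ∧ 0 ≤ x h 1 ∧ 0 ≤ x h 2 := by
    induction h with
    | zero => rw [hx00, hx01, hx02]; refine ⟨?_, ?_, ?_⟩ <;> linarith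
    | succ h ih =>
      obtain ⟨i0, i1, i2⟩ := ih
      have a1 : 0 ≤ 1 - ι := by linarith
      have a2 : 0 ≤ 1 - η := by linarith
      have a3 : 0 ≤ 1 - 2 * β := by linarith
      rw [hx0, hx1, hx2]
      refine ⟨?_, ?_, ?_⟩ <;> positivity
  have hupper (h : ℕ) : x h 2 ≤ β + η * h := by
    induction h with
    | zero => simp [hx02]
    | succ h ih =>
      obtain ⟨i0, i1, i2⟩ := hnn h
      have hle : x h 1 ≤ 1 := by linarith [hsum h]
      have e : η * x h 1 ≤ η := by nlinarith
      have e' : (1 - ι) * (x h 2 + η * x h 1) ≤ (1 - ι) * (β + η * h + η) :=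
        mul_le_mul_of_nonneg_left (by linarith) (by linarith)
      have : 0 ≤ ι * (η * h + η) := by positivity
      rw [hx2]
      push_cast
      nlinarith
  have hlow (h : ℕ) (hh : h + 1 ≤ H) : 1 / 6 ≤ x (h + 1) 1 := by
    have e0 : x (h + 1) 0 ≤ 1 / 3 := by rw [hx0]; nlinarith
    have hh' : ((h + 1 : ℕ) : ℝ) ≤ H := by exact_mod_cast hh
    have e2 : η * ((h + 1 : ℕ) : ℝ) ≤ η * H := mul_le_mul_of_nonneg_left hh' hη
    linarith [hsum (h + 1), hupper (h + 1)]
  change _ ≤ x (h + 1) 2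
  induction h with
  | zero =>
    have e : 0 ≤ (1 - ι) * (η * x 0 1) :=
      mul_nonneg (by linarith) (mul_nonneg hη (hnn 0).2.1)
    rw [hx2, hx02]
    simp
    linarith
  | succ h ih =>
    have ih := ih (by omega)
    have hl := hlow h (by omega)
    have e1 : η * (1 / 6) ≤ η * x (h + 1) 1 := mul_le_mul_of_nonneg_left hl hη
    have e2 : (1 - ι) * (β + η / 18 * (u / H) * h + η * (1 / 6)) ≤
        (1 - ι) * (x (h + 1) 2 + η * x (h + 1) 1) :=
      mul_le_mul_of_nonneg_left (by linarith) (by linarith)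
    have e3 : (u : ℝ) / H ≤ 1 := (div_le_one hH).2 huH'
    have e4 : ι * (u / H * h) ≤ 1 := by
      have : ι * (u / H * h) = h / H := by rw [hι]; field_simp
      rw [this, div_le_one hH]
      exact_mod_cast (by omega : h ≤ H)
    rw [hx2 (h + 1)]
    push_cast
    nlinarith [mul_le_mul_of_nonneg_left e3 hη, mul_le_mul_of_nonneg_left e4 hη,
      mul_le_mul_of_nonneg_left hι1 hη]

lemma regret_hardGame_learner (hu : 3 ≤ u) (huH : u ≤ H) (h0 : 0 ≤ β) (h1 : β ≤ 1 / 4)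
    (hη : 0 ≤ η) (hηH : η * H ≤ 1 / 4) :
    η * u * H / 162 ≤
      regret (hardGame u H β) (secondErrs ![0, η, 0]) (fun _ => Set.univ) := by
  have hu' : (3 : ℝ) ≤ u := by exact_mod_cast hu
  have huH' : (u : ℝ) ≤ H := by exact_mod_cast huH
  have hH : (0 : ℝ) < H := by linarith
  refine le_trans ?_ (le_regret (A := fun _ => Fin 2) _ _ 0 (fun _ _ => 1))
  have hdev := playsAs_dev ![0, η, 0] (fun _ _ => 1)
  rw [J_zero_eq hdev, J_zero_eq (playsAs_secondErrs _)]
  simp only [stateDist_of_obedient (playsAs_secondErrs _)]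
  obtain ⟨n, rfl⟩ : ∃ n, H = n + 1 := ⟨H - 1, by omega⟩
  rw [Finset.sum_range_succ', Finset.sum_range_succ']
  have hb : hardInit β 2 = β := by simp [hardInit]
  have hsum : ∑ h ∈ Finset.range n, (β + η / 18 * (u / (n + 1 : ℕ)) * h) ≤
      ∑ h ∈ Finset.range n, stateDist (hardGame u (n + 1) β)
        (dev (A := fun _ => Fin 2) (secondErrs ![0, η, 0]) 0 (fun _ _ => 1)) (h + 1) 2 :=
    Finset.sum_le_sum fun h hh => stateDist_two_lower hu huH h0 h1 hη hηH hdev h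
      (by have := Finset.mem_range.1 hh; omega)
  have hgauss : ∑ h ∈ Finset.range n, (h : ℝ) = n * (n - 1) / 2 := by
    clear * -
    induction n with
    | zero => simp
    | succ n ih => rw [Finset.sum_range_succ, ih]; push_cast; ring
  have h00 : stateDist (hardGame u (n + 1) β)
      (dev (A := fun _ => Fin 2) (secondErrs ![0, η, 0]) 0 (fun _ _ => 1)) 0 2 = β := by
    simp [stateDist, hardGame, hb]
  rw [Finset.sum_add_distrib, ← Finset.mul_sum, hgauss] at hsum
  have hn : (2 : ℝ) ≤ n := by exact_mod_cast (by omega : 2 ≤ n)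
  have hquad : ((n + 1 : ℕ) : ℝ) * (n + 1 : ℕ) / 9 ≤ n * (n - 1) / 2 := by
    push_cast; nlinarith
  have hmain : η * u * (n + 1 : ℕ) / 162 ≤
      η / 18 * (u / (n + 1 : ℕ)) * ((n : ℝ) * (n - 1) / 2) :=
    calc η * u * (n + 1 : ℕ) / 162
        = η / 18 * (u / (n + 1 : ℕ)) * (((n + 1 : ℕ) : ℝ) * (n + 1 : ℕ) / 9) := by
          field_simp
          ring
      _ ≤ _ := mul_le_mul_of_nonneg_left hquad (by positivity)
  rw [h00, hb]
  linarith

end Dynamics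

/-- **J-BC regret gap lower bound.** There is a universal constant
`c > 0` such that for all integers `u ≥ 3`, horizons `H ≥ u`, all `β ∈ (0, 1/4]`,
and all `ε > 0` with `ε·H ≤ β`, there exist a finite Markov Game with horizon `H`,
complete deviation classes, an expert satisfying `u`-recoverability and
`β`-coverage, and a learner with behavior-cloning error at most `ε`, whose regret
gap is at least `c·(1/β)·ε·u·H`. -/
theorem jbc_regret_gap_lower_bound :
    ∃ c : ℝ, 0 < c ∧
      ∀ (u H : ℕ), 3 ≤ u → u ≤ H →
      ∀ β : ℝ, 0 < β → β ≤ 1 / 4 →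
      ∀ ε : ℝ, 0 < ε → ε * H ≤ β →
      ∃ (m : ℕ) (_ : 0 < m) (nS : ℕ) (nA : Fin m → ℕ)
        (G : MG m (Fin nS) (fun i => Fin (nA i)))
        (Φ : ∀ i : Fin m, Set (Fin nS → Fin (nA i) → Fin (nA i)))
        (σE σ : Fin nS → (∀ i, Fin (nA i)) → ℝ),
        IsMG G ∧ G.H = H ∧ (∀ i, Φ i = Set.univ) ∧
        IsPolicy σE ∧ IsPolicy σ ∧
        Recoverable G Φ σE (u : ℝ) ∧ Coverage G σE β ∧
        (∑ s, dAvg G σE s * tv (σE s) (σ s)) ≤ ε ∧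
        c * (1 / β) * ε * u * H ≤ regret G σ Φ - regret G σE Φ := by
  refine ⟨1 / 648, by norm_num, fun u H hu huH β hβ hβ4 ε hε hεH => ?_⟩
  have hu' : (3 : ℝ) ≤ u := by exact_mod_cast hu
  have huH' : (u : ℝ) ≤ H := by exact_mod_cast huH
  set η := ε / (4 * β) with hηdef
  have hη : 0 ≤ η := by positivity
  have hηβ : β * η = ε / 4 := by rw [hηdef]; field_simp
  have hηH : η * H ≤ 1 / 4 := by
    rw [hηdef, div_mul_eq_mul_div, div_le_iff₀ (by positivity)]
    linarith
  have hη1 : η ≤ 1 := by nlinarith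
  refine ⟨2, by norm_num, 3, fun _ => 2, hardGame u H β, fun _ => Set.univ, secondErrs 0,
    secondErrs ![0, η, 0], isMG_hardGame hu hβ.le hβ4, rfl, fun _ => rfl,
    isPolicy_secondErrs (by simp) (by simp), isPolicy_secondErrs ?_ ?_,
    recoverable_hardGame hu _, ?_, ?_, ?_⟩
  · intro s; fin_cases s <;> simp [hη]
  · intro s; fin_cases s <;> simp [hη1]
  · intro s
    rw [dAvg_secondErrs_zero (by omega)]
    fin_cases s <;> simp [hardInit]
    linarith
  · simp only [dAvg_secondErrs_zero (show 0 < H by omega), tv]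
    have hs (f : (Fin 2 → Fin 2) → ℝ) := sum_fin_two_arrow f
    simp only [Fin.sum_univ_three, hs]
    simp [hardInit, secondErrs, abs_of_nonneg hη]
    linarith
  · rw [regret_hardGame_expert, sub_zero]
    refine le_trans (le_of_eq ?_) (regret_hardGame_learner hu huH hβ.le hβ4 hη hηH)
    rw [hηdef]
    field_simp
    ring

end MAIL
end
end
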